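/- For every ε > 0, every real λ, and every bounded continuous function g : [0,∞) → ℝ, there exists a real number α and a twice continuously differentiable function u : [0,∞) → ℝ such that u(0) = α, u'(0) = 0, ε²·u''(t) = u(t)³ − λ·u(t) + g(t) for all t ≥ 0, and u is bounded on [0,∞) (i.e., there is M with |u(t)| ≤ M for all t ≥ 0). -/

import Mathlib

open Real Set

open MeasureTheory Filter Topology

/-- The solution of `v' = -k * v + h` that stays bounded as `t → -∞`. -/
noncomputable def expAverage (k : ℝ) (h : ℝ → ℝ) (t : ℝ) : ℝ :=
  exp (-k * t) * ∫ s in Iic t, exp (k * s) * h s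

/-- The bounded solution of `u'' = k ^ 2 * u - h` on the line. -/
noncomputable def greenOp (k : ℝ) (h : ℝ → ℝ) (t : ℝ) : ℝ :=
  (expAverage k h t + expAverage k (fun s => h (-s)) (-t)) / (2 * k)

section

variable {k C : ℝ} {h h₁ h₂ : ℝ → ℝ}

theorem integrableOn_exp_mul_bdd (hk : 0 < k) (hm : Measurable h) (hC : ∀ t, |h t| ≤ C) (t : ℝ) :
    IntegrableOn (fun s => exp (k * s) * h s) (Iic t) :=
  (integrableOn_exp_mul_Iic hk t).mul_bdd hm.aestronglyMeasurable (ae_of_all _ hC)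

theorem intervalIntegrable_exp_mul_bdd (hk : 0 < k) (hm : Measurable h) (hC : ∀ t, |h t| ≤ C)
    (a b : ℝ) : IntervalIntegrable (fun s => exp (k * s) * h s) volume a b :=
  ⟨(integrableOn_exp_mul_bdd hk hm hC b).mono_set fun _ hx => hx.2,
    (integrableOn_exp_mul_bdd hk hm hC a).mono_set fun _ hx => hx.2⟩

theorem expAverage_eq (hk : 0 < k) (hm : Measurable h) (hC : ∀ t, |h t| ≤ C) :
    expAverage k h = fun t => exp (-k * t) *
      ((∫ s in Iic 0, exp (k * s) * h s) + ∫ s in (0 : ℝ)..t, exp (k * s) * h s) := by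
  ext t
  rw [expAverage, ← intervalIntegral.integral_Iic_sub_Iic (integrableOn_exp_mul_bdd hk hm hC 0)
    (integrableOn_exp_mul_bdd hk hm hC t), add_sub_cancel]

theorem continuous_expAverage (hk : 0 < k) (hm : Measurable h) (hC : ∀ t, |h t| ≤ C) :
    Continuous (expAverage k h) := by
  rw [expAverage_eq hk hm hC]
  have := intervalIntegral.continuous_primitive (intervalIntegrable_exp_mul_bdd hk hm hC) 0
  fun_prop

theorem hasDerivAt_expAverage (hk : 0 < k) (hh : Continuous h) (hC : ∀ t, |h t| ≤ C) (t : ℝ) :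
    HasDerivAt (expAverage k h) (h t - k * expAverage k h t) t := by
  rw [expAverage_eq hk hh.measurable hC]
  have hc : Continuous fun s => exp (k * s) * h s := by fun_prop
  have h1 := (hc.integral_hasStrictDerivAt 0 t).hasDerivAt.const_add
    (∫ s in Iic 0, exp (k * s) * h s)
  have h2 : HasDerivAt (fun t => exp (-k * t)) (exp (-k * t) * (-k * 1)) t :=
    ((hasDerivAt_id t).const_mul (-k)).exp
  refine (h2.mul h1).congr_deriv ?_
  have : exp (-k * t) * exp (k * t) = 1 := by rw [← exp_add]; simp
  linear_combination h t * this

theorem expAverage_const (hk : 0 < k) (c t : ℝ) : expAverage k (fun _ => c) t = c / k := by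
  rw [expAverage, integral_mul_const, integral_exp_mul_Iic hk]
  have : exp (-k * t) * exp (k * t) = 1 := by rw [← exp_add]; simp
  linear_combination c / k * this

theorem expAverage_mono (hk : 0 < k) (hm₁ : Measurable h₁) (hC₁ : ∀ t, |h₁ t| ≤ C)
    (hm₂ : Measurable h₂) (hC₂ : ∀ t, |h₂ t| ≤ C) (hle : ∀ t, h₁ t ≤ h₂ t) (t : ℝ) :
    expAverage k h₁ t ≤ expAverage k h₂ t :=
  mul_le_mul_of_nonneg_left
    (setIntegral_mono (integrableOn_exp_mul_bdd hk hm₁ hC₁ t)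
      (integrableOn_exp_mul_bdd hk hm₂ hC₂ t)
      fun s => mul_le_mul_of_nonneg_left (hle s) (exp_pos _).le) (exp_pos _).le

theorem tendsto_expAverage (hk : 0 < k) {H : ℕ → ℝ → ℝ} (hm : ∀ n, Measurable (H n))
    (hC : ∀ n t, |H n t| ≤ C) (hlim : ∀ t, Tendsto (fun n => H n t) atTop (𝓝 (h t))) (t : ℝ) :
    Tendsto (fun n => expAverage k (H n) t) atTop (𝓝 (expAverage k h t)) := by
  refine Tendsto.const_mul _ (tendsto_integral_of_dominated_convergence
    (fun s => exp (k * s) * C) (fun n => ?_) ((integrableOn_exp_mul_Iic hk t).mul_const C)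
    (fun n => ae_of_all _ fun s => ?_) (ae_of_all _ fun s => (hlim s).const_mul _))
  · exact (integrableOn_exp_mul_bdd hk (hm n) (hC n) t).aestronglyMeasurable
  · rw [norm_mul, norm_of_nonneg (exp_pos _).le]
    exact mul_le_mul_of_nonneg_left (hC n s) (exp_pos _).le

theorem continuous_greenOp (hk : 0 < k) (hm : Measurable h) (hC : ∀ t, |h t| ≤ C) :
    Continuous (greenOp k h) := by
  have h1 := continuous_expAverage hk hm hC
  have h2 := continuous_expAverage hk (hm.comp measurable_neg) fun t => hC (-t)
  exact (h1.add (h2.comp continuous_neg)).div_const _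

theorem greenOp_even (heven : ∀ t, h (-t) = h t) (t : ℝ) : greenOp k h (-t) = greenOp k h t := by
  simp only [greenOp, heven, neg_neg, add_comm]

theorem greenOp_const (hk : 0 < k) (c t : ℝ) : greenOp k (fun _ => k ^ 2 * c) t = c := by
  simp only [greenOp, expAverage_const hk]
  field_simp
  ring

theorem greenOp_mono (hk : 0 < k) (hm₁ : Measurable h₁) (hC₁ : ∀ t, |h₁ t| ≤ C)
    (hm₂ : Measurable h₂) (hC₂ : ∀ t, |h₂ t| ≤ C) (hle : ∀ t, h₁ t ≤ h₂ t) (t : ℝ) :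
    greenOp k h₁ t ≤ greenOp k h₂ t := by
  have h1 := expAverage_mono hk hm₁ hC₁ hm₂ hC₂ hle t
  have h2 := expAverage_mono hk (hm₁.comp measurable_neg) (fun t => hC₁ (-t))
    (hm₂.comp measurable_neg) (fun t => hC₂ (-t)) (fun t => hle (-t)) (-t)
  exact div_le_div_of_nonneg_right (add_le_add h1 h2) (by positivity)

theorem tendsto_greenOp (hk : 0 < k) {H : ℕ → ℝ → ℝ} (hm : ∀ n, Measurable (H n))
    (hC : ∀ n t, |H n t| ≤ C) (hlim : ∀ t, Tendsto (fun n => H n t) atTop (𝓝 (h t))) (t : ℝ) :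
    Tendsto (fun n => greenOp k (H n) t) atTop (𝓝 (greenOp k h t)) :=
  ((tendsto_expAverage hk hm hC hlim t).add
    (tendsto_expAverage hk (fun n => (hm n).comp measurable_neg) (fun n t => hC n (-t))
      (fun t => hlim (-t)) (-t))).div_const _

theorem greenOp_contDiff_and_deriv_deriv (hk : 0 < k) (hh : Continuous h) (hC : ∀ t, |h t| ≤ C) :
    ContDiff ℝ 2 (greenOp k h) ∧
      ∀ t, deriv (deriv (greenOp k h)) t = k ^ 2 * greenOp k h t - h t := by
  have hL := hasDerivAt_expAverage hk hh hC
  have hR (t : ℝ) : HasDerivAt (fun t => expAverage k (fun s => h (-s)) (-t))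
      (k * expAverage k (fun s => h (-s)) (-t) - h t) t := by
    refine ((hasDerivAt_expAverage hk (hh.comp continuous_neg) (fun t => hC (-t)) (-t)).comp t
      (hasDerivAt_neg t)).congr_deriv ?_
    simp only [Function.comp_def, neg_neg]
    ring
  have h1 (t : ℝ) : HasDerivAt (greenOp k h)
      ((expAverage k (fun s => h (-s)) (-t) - expAverage k h t) / 2) t := by
    refine (((hL t).add (hR t)).div_const (2 * k)).congr_deriv ?_
    field_simp
    ring
  have h2 (t : ℝ) : HasDerivAt (deriv (greenOp k h)) (k ^ 2 * greenOp k h t - h t) t := by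
    rw [funext fun t => (h1 t).deriv]
    refine (((hR t).sub (hL t)).div_const 2).congr_deriv ?_
    rw [greenOp]
    field_simp
    ring
  have hd2 : deriv (deriv (greenOp k h)) = fun t => k ^ 2 * greenOp k h t - h t :=
    funext fun t => (h2 t).deriv
  have hc := continuous_greenOp hk hh.measurable hC
  refine ⟨?_, congrFun hd2⟩
  rw [show (2 : WithTop ℕ∞) = 1 + 1 from (one_add_one_eq_two).symm, contDiff_succ_iff_deriv]
  refine ⟨fun t => (h1 t).differentiableAt, by simp, ?_⟩
  rw [contDiff_one_iff_deriv, hd2]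
  exact ⟨fun t => (h2 t).differentiableAt, by fun_prop⟩

/-- Monotone iteration between the constant sub- and supersolutions `-R` and `R`. -/
theorem exists_even_bounded_solution {Φ : ℝ → ℝ → ℝ} {R : ℝ} (hk : 0 < k) (hR : 0 ≤ R)
    (hΦ : Continuous fun p : ℝ × ℝ => Φ p.1 p.2) (heven : ∀ t x, Φ (-t) x = Φ t x)
    (hmono : ∀ t, MonotoneOn (Φ t) (Icc (-R) R)) (hlow : ∀ t, k ^ 2 * -R ≤ Φ t (-R))
    (hupp : ∀ t, Φ t R ≤ k ^ 2 * R) :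
    ∃ u : ℝ → ℝ, ContDiff ℝ 2 u ∧ (∀ t, u (-t) = u t) ∧ (∀ t, |u t| ≤ R) ∧
      ∀ t, deriv (deriv u) t = k ^ 2 * u t - Φ t (u t) := by
  have hRR : -R ≤ R := by linarith
  have hlo (t x : ℝ) (hx : x ∈ Icc (-R) R) : k ^ 2 * -R ≤ Φ t x :=
    (hlow t).trans (hmono t (left_mem_Icc.2 hRR) hx hx.1)
  have hhi (t x : ℝ) (hx : x ∈ Icc (-R) R) : Φ t x ≤ k ^ 2 * R :=
    (hmono t hx (right_mem_Icc.2 hRR) hx.2).trans (hupp t)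
  have hbd (t x : ℝ) (hx : x ∈ Icc (-R) R) : |Φ t x| ≤ k ^ 2 * R :=
    abs_le.2 ⟨by linarith [hlo t x hx], hhi t x hx⟩
  have hcb (c : ℝ) (hc : c ∈ Icc (-R) R) (_ : ℝ) : |k ^ 2 * c| ≤ k ^ 2 * R := by
    rw [abs_mul, abs_of_nonneg (sq_nonneg k)]
    exact mul_le_mul_of_nonneg_left (abs_le.2 hc) (sq_nonneg k)
  have hmeas {v : ℝ → ℝ} (hv : Measurable v) : Measurable fun t => Φ t (v t) :=
    hΦ.measurable.comp (measurable_id.prodMk hv)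
  have hmaps {v : ℝ → ℝ} (hv : Measurable v) (hvR : ∀ t, v t ∈ Icc (-R) R) (t : ℝ) :
      greenOp k (fun t => Φ t (v t)) t ∈ Icc (-R) R := by
    constructor
    · rw [← greenOp_const hk (-R) t]
      exact greenOp_mono hk measurable_const (hcb _ (left_mem_Icc.2 hRR)) (hmeas hv)
        (fun t => hbd t _ (hvR t)) (fun t => hlo t _ (hvR t)) t
    · conv_rhs => rw [← greenOp_const hk R t]
      exact greenOp_mono hk (hmeas hv) (fun t => hbd t _ (hvR t)) measurable_const
        (hcb _ (right_mem_Icc.2 hRR)) (fun t => hhi t _ (hvR t)) t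
  let S : (ℝ → ℝ) → ℝ → ℝ := fun v => greenOp k fun t => Φ t (v t)
  let w : ℕ → ℝ → ℝ := fun n => S^[n] fun _ => -R
  have hw (n : ℕ) : w (n + 1) = S (w n) := Function.iterate_succ_apply' S n _
  have hinv (n : ℕ) : Measurable (w n) ∧ (∀ t, w n t ∈ Icc (-R) R) ∧ ∀ t, w n (-t) = w n t := by
    induction n with
    | zero => exact ⟨measurable_const, fun _ => left_mem_Icc.2 hRR, fun _ => rfl⟩
    | succ n ih =>
      obtain ⟨hm, hI, he⟩ := ih
      rw [hw]
      exact ⟨(continuous_greenOp hk (hmeas hm) fun t => hbd t _ (hI t)).measurable,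
        hmaps hm hI, greenOp_even fun t => by rw [heven, he]⟩
  have hwmono (t : ℝ) : Monotone fun n => w n t := by
    refine monotone_nat_of_le_succ fun n => ?_
    induction n generalizing t with
    | zero => exact ((hinv 1).2.1 t).1
    | succ n ih =>
      rw [hw (n + 1), hw n]
      exact greenOp_mono hk (hmeas (hinv n).1) (fun t => hbd t _ ((hinv n).2.1 t))
        (hmeas (hw n ▸ (hinv (n + 1)).1)) (fun t => hbd t _ (hw n ▸ (hinv (n + 1)).2.1 t))
        (fun t => hmono t ((hinv n).2.1 t) (hw n ▸ (hinv (n + 1)).2.1 t) (hw n ▸ ih t)) t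
  have hbdd (t : ℝ) : BddAbove (range fun n => w n t) :=
    ⟨R, by rintro _ ⟨n, rfl⟩; exact ((hinv n).2.1 t).2⟩
  let u : ℝ → ℝ := fun t => ⨆ n, w n t
  have hlim (t : ℝ) : Tendsto (fun n => w n t) atTop (𝓝 (u t)) :=
    tendsto_atTop_ciSup (hwmono t) (hbdd t)
  have hum : Measurable u := .iSup fun n => (hinv n).1
  have huI (t : ℝ) : u t ∈ Icc (-R) R :=
    isClosed_Icc.mem_of_tendsto (hlim t) (Eventually.of_forall fun n => (hinv n).2.1 t)
  have hfix : greenOp k (fun t => Φ t (u t)) = u := by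
    ext t
    refine tendsto_nhds_unique (tendsto_greenOp hk (fun n => hmeas (hinv n).1)
      (fun n t => hbd t _ ((hinv n).2.1 t)) (fun t => ?_) t)
      (((hlim t).comp (tendsto_add_atTop_nat 1)).congr fun n => congrFun (hw n) t)
    exact (hΦ.tendsto (t, u t)).comp (tendsto_const_nhds.prodMk_nhds (hlim t))
  have hbdu (t : ℝ) : |Φ t (u t)| ≤ k ^ 2 * R := hbd t _ (huI t)
  have huc : Continuous u := hfix ▸ continuous_greenOp hk (hmeas hum) hbdu
  obtain ⟨hC2, hode⟩ := greenOp_contDiff_and_deriv_deriv hk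
    (hΦ.comp (continuous_id.prodMk huc)) hbdu
  simp only [Function.comp_def, id_eq, hfix] at hC2 hode
  exact ⟨u, hC2, fun t => by simp only [u, (hinv _).2.2], fun t => abs_le.2 (huI t), hode⟩

end

theorem deriv_zero_of_even {u : ℝ → ℝ} (hu : ∀ t, u (-t) = u t) : deriv u 0 = 0 := by
  have h := deriv_comp_neg u 0
  simp only [hu, neg_zero] at h
  linarith

theorem monotoneOn_linear_sub_cube {m R : ℝ} (hm : 3 * R ^ 2 ≤ m) :
    MonotoneOn (fun x : ℝ => m * x - x ^ 3) (Icc (-R) R) := by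
  intro x hx y hy hxy
  have hx2 : x ^ 2 ≤ R ^ 2 := sq_le_sq' hx.1 hx.2
  have hy2 : y ^ 2 ≤ R ^ 2 := sq_le_sq' hy.1 hy.2
  have hq : 0 ≤ m - (x ^ 2 + x * y + y ^ 2) := by nlinarith [sq_nonneg (x - y)]
  have := mul_nonneg (sub_nonneg.2 hxy) hq
  change m * x - x ^ 3 ≤ m * y - y ^ 3
  linarith

/-- For every `ε > 0`, every real `λ`, and every bounded continuous function
`g` on `[0,∞)`, the ODE `ε²·u'' = u³ − λ·u + g(t)` has a solution with
`u(0) = α`, `u'(0) = 0` which is bounded on `[0,∞)`. -/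
theorem stmt_0 (ε lam : ℝ) (hε : 0 < ε) (g : ℝ → ℝ)
    (hg_cont : ContinuousOn g (Ici (0 : ℝ)))
    (hg_bdd : ∃ C : ℝ, ∀ t ∈ Ici (0 : ℝ), |g t| ≤ C) :
    ∃ (α : ℝ) (u : ℝ → ℝ), ContDiff ℝ 2 u ∧ u 0 = α ∧ deriv u 0 = 0 ∧
      (∀ t ∈ Ici (0 : ℝ), ε ^ 2 * deriv (deriv u) t = u t ^ 3 - lam * u t + g t) ∧
      ∃ M : ℝ, ∀ t ∈ Ici (0 : ℝ), |u t| ≤ M := by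
  obtain ⟨C, hC⟩ := hg_bdd
  have hC0 : 0 ≤ C := (abs_nonneg _).trans (hC 0 self_mem_Ici)
  have hgC (t : ℝ) : |g (|t|)| ≤ C := hC _ (abs_nonneg t)
  have hgc : Continuous fun t => g |t| :=
    hg_cont.comp_continuous continuous_abs fun t => abs_nonneg t
  set R : ℝ := 1 + |lam| + C with hRdef
  have hl := abs_nonneg lam
  have hll := le_abs_self lam
  have hR : 0 ≤ R := by positivity
  have hRC : C ≤ R ^ 3 - lam * R := by
    have h1 : 1 ≤ R ^ 2 - lam := by nlinarith
    nlinarith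
  set k : ℝ := (1 + 3 * R ^ 2 + |lam|) / ε with hkdef
  have hk : 0 < k := by positivity
  have hkε : k * ε = 1 + 3 * R ^ 2 + |lam| := by rw [hkdef]; field_simp
  have hm : 3 * R ^ 2 ≤ (k * ε) ^ 2 + lam := by
    rw [hkε]
    nlinarith [neg_abs_le lam, sq_nonneg R, sq_nonneg (3 * R ^ 2 + |lam|)]
  obtain ⟨u, hu2, hue, huR, hode⟩ := exists_even_bounded_solution (k := k) (R := R)
    (Φ := fun t x => ((((k * ε) ^ 2 + lam) * x - x ^ 3) - g |t|) / ε ^ 2) hk hR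
    (((by fun_prop : Continuous fun p : ℝ × ℝ => ((k * ε) ^ 2 + lam) * p.2 - p.2 ^ 3).sub
      (hgc.comp continuous_fst)).div_const _)
    (fun t x => by simp only [abs_neg])
    (fun t x hx y hy hxy => by
      have := monotoneOn_linear_sub_cube hm hx hy hxy
      exact div_le_div_of_nonneg_right (sub_le_sub_right this _) (by positivity))
    (fun t => by
      rw [le_div_iff₀ (by positivity)]
      linarith [(abs_le.1 (hgC t)).2])
    (fun t => by
      rw [div_le_iff₀ (by positivity)]
      linarith [(abs_le.1 (hgC t)).1])
  refine ⟨u 0, u, hu2, rfl, deriv_zero_of_even hue, fun t ht => ?_, R, fun t _ => huR t⟩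
  rw [hode, abs_of_nonneg ht]
  field_simp
  ring
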